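/- arXiv:2404.11755 — 2 statements merged into one kernel-verified Lean document; each statement's English description precedes it below -/
import Mathlib

section
/- (Energy equality for the hybrid model, continuous case.) Let d ≥ 1, ν > 0, α > 0, β ∈ ℝ, let f : ℝᵈ → ℝᵈ be continuous, and let (w, λ) be a classical compactly supported solution of the hybrid model: w : ℝ × ℝᵈ → ℝᵈ and λ : ℝ × ℝᵈ → ℝ are twice continuously differentiable jointly in (t, x), there is a compact set K ⊂ ℝᵈ with supp w(t,·) ⊆ K and supp λ(t,·) ⊆ K for every t, and for all (t, x): ∂_t w + (w·∇)w + (1/2)(div w)·w − νΔw + ∇λ = f and ∂_t λ + 2β·div(∂_t w) + α²·div w = 0. Then for every t, (d/dt)[ (1/2)∫_{ℝᵈ}|w(t,x)|² dx + (α⁻²/2)∫_{ℝᵈ}(λ(t,x) + 2β·div w(t,x))² dx ] + ν∫_{ℝᵈ}|Dw(t,x)|² dx + 2β∫_{ℝᵈ}(div w(t,x))² dx = ∫_{ℝᵈ} f(x)·w(t,x) dx, where |Dw|² denotes the squared Frobenius norm of the spatial Jacobian of w. -/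
open MeasureTheory

/-- Euclidean dot product on `Fin d → ℝ`. -/
def dotProd {d : ℕ} (a b : Fin d → ℝ) : ℝ := ∑ i, a i * b i

/-- Divergence of a vector field on `ℝᵈ`. -/
noncomputable def vdiv {d : ℕ} (u : (Fin d → ℝ) → (Fin d → ℝ))
    (x : Fin d → ℝ) : ℝ := ∑ i, fderiv ℝ u x (Pi.single i 1) i

/-- `i`-th component of the (componentwise) Laplacian of a vector field. -/
noncomputable def vlap {d : ℕ} (u : (Fin d → ℝ) → (Fin d → ℝ))
    (x : Fin d → ℝ) (i : Fin d) : ℝ :=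
  ∑ j, fderiv ℝ (fun y => fderiv ℝ u y (Pi.single j 1) i) x (Pi.single j 1)

/-- Squared Frobenius norm of the spatial Jacobian of a vector field. -/
noncomputable def frobSq {d : ℕ} (u : (Fin d → ℝ) → (Fin d → ℝ))
    (x : Fin d → ℝ) : ℝ := ∑ i, ∑ j, (fderiv ℝ u x (Pi.single j 1) i) ^ 2

/-- A continuous function vanishing off a compact set is integrable. -/
lemma integrable_of_continuous_of_eq_zero_off {d : ℕ} {K : Set (Fin d → ℝ)} (hK : IsCompact K)
    {g : (Fin d → ℝ) → ℝ} (hg : Continuous g) (h0 : ∀ x ∉ K, g x = 0) : Integrable g :=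
  hg.integrable_of_hasCompactSupport (HasCompactSupport.intro hK h0)

/-- The derivative of a function vanishing off a closed set vanishes off that set. -/
lemma fderiv_eq_zero_off {E F : Type*} [NormedAddCommGroup E] [NormedSpace ℝ E]
    [NormedAddCommGroup F] [NormedSpace ℝ F] {K : Set E} (hK : IsClosed K) {g : E → F}
    (h0 : ∀ x ∉ K, g x = 0) {x : E} (hx : x ∉ K) : fderiv ℝ g x = 0 := by
  have h : g =ᶠ[nhds x] fun _ => 0 := by
    filter_upwards [hK.isOpen_compl.mem_nhds hx] with y hy using h0 y hy
  rw [h.fderiv_eq, fderiv_fun_const]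
  rfl

/-- Differentiation under the integral sign for `C¹` functions with uniformly compact support. -/
lemma hasDerivAt_integral_of_contDiff_of_eq_zero_off {d : ℕ} {K : Set (Fin d → ℝ)}
    (hK : IsCompact K) {G : ℝ → (Fin d → ℝ) → ℝ}
    (hG : ContDiff ℝ 1 (fun q : ℝ × (Fin d → ℝ) => G q.1 q.2))
    (h0 : ∀ t, ∀ x ∉ K, G t x = 0) (t : ℝ) {G' : (Fin d → ℝ) → ℝ}
    (hG' : ∀ x, HasDerivAt (fun s => G s x) (G' x) t) :
    HasDerivAt (fun s => ∫ x, G s x) (∫ x, G' x) t := by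
  set D : ℝ × (Fin d → ℝ) → ℝ :=
    fun q => fderiv ℝ (fun q : ℝ × (Fin d → ℝ) => G q.1 q.2) q (1, 0) with hD
  have hDc : Continuous D := (hG.continuous_fderiv (by simp)).clm_apply continuous_const
  have hder : ∀ s x, HasDerivAt (fun s => G s x) (D (s, x)) s := fun s x =>
    HasFDerivAt.comp_hasDerivAt (l := fun q : ℝ × (Fin d → ℝ) => G q.1 q.2) s
      ((hG.differentiable (by simp)) (s, x)).hasFDerivAt
      ((hasDerivAt_id s).prodMk (hasDerivAt_const s x))
  have hG'D : G' = fun x => D (t, x) := funext fun x => (hG' x).unique (hder t x)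
  obtain ⟨C, hC⟩ := ((isCompact_Icc (a := t - 1) (b := t + 1)).prod hK).exists_bound_of_continuousOn
    hDc.continuousOn
  rw [hG'D]
  refine (hasDerivAt_integral_of_dominated_loc_of_deriv_le (F' := fun s x => D (s, x))
    (bound := K.indicator fun _ => C) (Icc_mem_nhds (sub_one_lt t) (lt_add_one t)) ?_ ?_ ?_ ?_ ?_
    ?_).2
  · refine Filter.Eventually.of_forall fun s => Continuous.aestronglyMeasurable ?_
    exact hG.continuous.comp (Continuous.prodMk_right s)
  · exact integrable_of_continuous_of_eq_zero_off hK
      (hG.continuous.comp (Continuous.prodMk_right t)) (h0 t)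
  · exact (hDc.comp (Continuous.prodMk_right t)).aestronglyMeasurable
  · refine Filter.Eventually.of_forall fun x s hs => ?_
    by_cases hx : x ∈ K
    · simpa [hx] using hC (s, x) ⟨hs, hx⟩
    · have hzero : (fun s => G s x) = fun _ => 0 := funext fun s => h0 s x hx
      have h := hder s x
      rw [hzero] at h
      simp [hx, h.unique (hasDerivAt_const s (0 : ℝ))]
  · exact (integrable_indicator_iff hK.isClosed.measurableSet).2
      (integrableOn_const hK.measure_lt_top.ne)
  · exact Filter.Eventually.of_forall fun x s _ => hder s x

lemma vdiv_eq_sum_fderiv_apply {d : ℕ} {u : (Fin d → ℝ) → (Fin d → ℝ)} {x : Fin d → ℝ}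
    (hu : DifferentiableAt ℝ u x) :
    vdiv u x = ∑ i, fderiv ℝ (fun y => u y i) x (Pi.single i 1) := by
  refine Finset.sum_congr rfl fun i _ => ?_
  rw [(hasFDerivAt_pi'.1 hu.hasFDerivAt i).fderiv]
  rfl

lemma fderiv_comp_apply {d : ℕ} {E : Type*} [NormedAddCommGroup E] [NormedSpace ℝ E]
    {u : E → (Fin d → ℝ)} {x : E} (hu : DifferentiableAt ℝ u x) (v : E) (i : Fin d) :
    fderiv ℝ (fun y => u y i) x v = fderiv ℝ u x v i := by
  rw [(hasFDerivAt_pi'.1 hu.hasFDerivAt i).fderiv]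
  rfl

lemma continuous_vdiv {d : ℕ} {u : (Fin d → ℝ) → (Fin d → ℝ)} (hu : ContDiff ℝ 1 u) :
    Continuous (vdiv u) :=
  continuous_finsetSum _ fun i _ =>
    (continuous_apply i).comp ((hu.continuous_fderiv (by simp)).clm_apply continuous_const)

lemma vdiv_eq_zero_off {d : ℕ} {K : Set (Fin d → ℝ)} (hK : IsClosed K)
    {u : (Fin d → ℝ) → (Fin d → ℝ)} (h0 : ∀ x ∉ K, u x = 0) {x : Fin d → ℝ} (hx : x ∉ K) :
    vdiv u x = 0 := by
  simp [vdiv, fderiv_eq_zero_off hK h0 hx]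

/-- Divergence theorem for compactly supported `C¹` vector fields. -/
lemma integral_vdiv_eq_zero {d : ℕ} {K : Set (Fin d → ℝ)} (hK : IsCompact K)
    {u : (Fin d → ℝ) → (Fin d → ℝ)} (hu : ContDiff ℝ 1 u) (h0 : ∀ x ∉ K, u x = 0) :
    ∫ x, vdiv u x = 0 := by
  have hc (i : Fin d) : ContDiff ℝ 1 (fun y => u y i) := contDiff_pi.1 hu i
  have h0' (i : Fin d) : ∀ x ∉ K, u x i = 0 := fun x hx => by simp [h0 x hx]
  have hint (i : Fin d) :
      Integrable (fun x => fderiv ℝ (fun y => u y i) x (Pi.single i 1)) :=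
    integrable_of_continuous_of_eq_zero_off hK
      (((hc i).continuous_fderiv (by simp)).clm_apply continuous_const) fun x hx => by
        simp [fderiv_eq_zero_off hK.isClosed (h0' i) hx]
  simp_rw [vdiv_eq_sum_fderiv_apply ((hu.differentiable (by simp)) _)]
  rw [integral_finsetSum _ fun i _ => hint i]
  refine Finset.sum_eq_zero fun i _ => ?_
  have h := integral_mul_fderiv_eq_neg_fderiv_mul_of_integrable (μ := (volume : Measure (Fin d → ℝ)))
    (f := fun _ => (1 : ℝ)) (g := fun y => u y i) (v := Pi.single i 1) (by simp)
    (by simpa using hint i)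
    (by simpa using integrable_of_continuous_of_eq_zero_off hK (hc i).continuous (h0' i))
    (fun _ _ => differentiableAt_const _) (fun x _ => (hc i).differentiable (by simp) x)
  simpa using h

/-- The energy flux `½|u|²u - ν (Du)ᵀu + p u`. -/
noncomputable def energyFlux {d : ℕ} (ν : ℝ) (u : (Fin d → ℝ) → (Fin d → ℝ))
    (p : (Fin d → ℝ) → ℝ) (x : Fin d → ℝ) (j : Fin d) : ℝ :=
  1 / 2 * (∑ i, u x i ^ 2) * u x j - ν * (∑ i, u x i * fderiv ℝ u x (Pi.single j 1) i) + p x * u x j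

lemma contDiff_fderiv_apply_apply {d : ℕ} {u : (Fin d → ℝ) → (Fin d → ℝ)} (hu : ContDiff ℝ 2 u)
    (v : Fin d → ℝ) (i : Fin d) : ContDiff ℝ 1 (fun y => fderiv ℝ u y v i) :=
  contDiff_pi.1 ((hu.fderiv_right (by norm_num)).clm_apply contDiff_const) i

lemma contDiff_energyFlux {d : ℕ} (ν : ℝ) {u : (Fin d → ℝ) → (Fin d → ℝ)} (hu : ContDiff ℝ 2 u)
    {p : (Fin d → ℝ) → ℝ} (hp : ContDiff ℝ 2 p) : ContDiff ℝ 1 (energyFlux ν u p) := by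
  have hui (i : Fin d) : ContDiff ℝ 1 (fun y => u y i) :=
    (contDiff_pi.1 hu i).of_le (by norm_num)
  have hp1 : ContDiff ℝ 1 p := hp.of_le (by norm_num)
  refine contDiff_pi.2 fun j => ?_
  refine ((contDiff_const.mul (ContDiff.sum fun i _ => (hui i).pow 2)).mul (hui j)).sub
    (contDiff_const.mul (ContDiff.sum fun i _ => (hui i).mul
      (contDiff_fderiv_apply_apply hu _ i))) |>.add (hp1.mul (hui j))

/-- Testing the spatial terms of the momentum equation against `u`: up to the divergence of the
energy flux only `ν|Du|²` and `-p div u` remain. -/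
lemma vdiv_energyFlux {d : ℕ} (ν : ℝ) {u : (Fin d → ℝ) → (Fin d → ℝ)} (hu : ContDiff ℝ 2 u)
    {p : (Fin d → ℝ) → ℝ} (hp : ContDiff ℝ 2 p) (x : Fin d → ℝ) :
    vdiv (energyFlux ν u p) x + ν * frobSq u x - p x * vdiv u x =
      ∑ i, u x i * (fderiv ℝ u x (u x) i + 1 / 2 * vdiv u x * u x i - ν * vlap u x i
        + fderiv ℝ p x (Pi.single i 1)) := by
  have hud : DifferentiableAt ℝ u x := hu.differentiable (by simp) x
  have hU (i : Fin d) := ((contDiff_pi.1 hu i).differentiable (by simp) x).hasFDerivAt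
  have hD (i j : Fin d) := ((contDiff_fderiv_apply_apply hu (Pi.single j 1) i).differentiable
    (by simp) x).hasFDerivAt
  have hP := (hp.differentiable (by simp) x).hasFDerivAt
  have hflux (j : Fin d) : fderiv ℝ (fun y => energyFlux ν u p y j) x (Pi.single j 1) =
      (∑ i, u x j * (u x i * fderiv ℝ u x (Pi.single j 1) i))
      + 1 / 2 * (∑ i, u x i ^ 2) * fderiv ℝ u x (Pi.single j 1) j
      - ν * (∑ i, fderiv ℝ u x (Pi.single j 1) i ^ 2)
      - ν * (∑ i, u x i *
          fderiv ℝ (fun y => fderiv ℝ u y (Pi.single j 1) i) x (Pi.single j 1))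
      + u x j * fderiv ℝ p x (Pi.single j 1) + p x * fderiv ℝ u x (Pi.single j 1) j := by
    have h := (((HasFDerivAt.fun_sum (u := Finset.univ) fun i _ => (hU i).pow 2).const_mul
      (1 / 2 : ℝ)).mul (hU j)).sub
      ((HasFDerivAt.fun_sum (u := Finset.univ) fun i _ => (hU i).mul (hD i j)).const_mul ν)
      |>.add (hP.mul (hU j))
    have h' : HasFDerivAt (fun y => energyFlux ν u p y j) _ x := h
    rw [h'.fderiv]
    simp only [_root_.add_apply, _root_.sub_apply, _root_.smul_apply, _root_.sum_apply,
      smul_eq_mul, fderiv_comp_apply hud, Finset.sum_add_distrib]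
    have h1 : ∑ i, ((2 : ℕ) • u x i ^ (2 - 1)) * fderiv ℝ u x (Pi.single j 1) i =
        2 * ∑ i, u x i * fderiv ℝ u x (Pi.single j 1) i := by
      rw [Finset.mul_sum]
      refine Finset.sum_congr rfl fun i _ => ?_
      simp only [nsmul_eq_mul]
      push_cast
      ring
    have h2 : ∑ i, fderiv ℝ u x (Pi.single j 1) i * fderiv ℝ u x (Pi.single j 1) i =
        ∑ i, fderiv ℝ u x (Pi.single j 1) i ^ 2 := by simp only [sq]
    rw [h1, h2, ← Finset.mul_sum]
    ring
  have hadv (i : Fin d) : fderiv ℝ u x (u x) i = ∑ j, u x j * fderiv ℝ u x (Pi.single j 1) i := by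
    conv_lhs => rw [← LinearMap.sum_single_apply (fun _ => ℝ) (u x)]
    rw [map_sum, Finset.sum_apply]
    refine Finset.sum_congr rfl fun j _ => ?_
    have h : (Pi.single j (u x j) : Fin d → ℝ) = u x j • Pi.single j (1 : ℝ) := by
      rw [← Pi.single_smul', smul_eq_mul, mul_one]
    simp [h]
  have hcubic : ∑ j, u x j * ∑ i, u x i * fderiv ℝ u x (Pi.single j 1) i =
      ∑ i, u x i * ∑ j, u x j * fderiv ℝ u x (Pi.single j 1) i := by
    simp only [Finset.mul_sum]
    rw [Finset.sum_comm]
    simp only [mul_left_comm]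
  have hsq : ∑ i, u x i * (1 / 2 * vdiv u x * u x i) = 1 / 2 * (∑ i, u x i ^ 2) * vdiv u x := by
    rw [Finset.mul_sum, Finset.sum_mul]
    exact Finset.sum_congr rfl fun i _ => by ring
  have hlap : ∑ i, u x i * (ν * vlap u x i) = ν * ∑ j, ∑ i, u x i *
      fderiv ℝ (fun y => fderiv ℝ u y (Pi.single j 1) i) x (Pi.single j 1) := by
    rw [Finset.sum_comm, Finset.mul_sum]
    exact Finset.sum_congr rfl fun i _ => by rw [← Finset.mul_sum, vlap]; ring
  have hfrob : frobSq u x = ∑ j, ∑ i, fderiv ℝ u x (Pi.single j 1) i ^ 2 := Finset.sum_comm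
  rw [vdiv_eq_sum_fderiv_apply ((contDiff_energyFlux ν hu hp).differentiable (by simp) x)]
  simp only [hflux, hadv, mul_add, mul_sub, Finset.sum_add_distrib, Finset.sum_sub_distrib,
    hsq, hlap, hfrob, ← Finset.mul_sum, hcubic]
  simp only [vdiv]
  ring

lemma fderiv_slice_apply {E F : Type*} [NormedAddCommGroup E] [NormedSpace ℝ E]
    [NormedAddCommGroup F] [NormedSpace ℝ F] {w : ℝ → E → F} {t : ℝ} {x : E}
    (hw : DifferentiableAt ℝ (fun q : ℝ × E => w q.1 q.2) (t, x)) (v : E) :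
    fderiv ℝ (w t) x v = fderiv ℝ (fun q : ℝ × E => w q.1 q.2) (t, x) (0, v) := by
  have h : HasFDerivAt (w t) _ x := hw.hasFDerivAt.comp x (hasFDerivAt_prodMk_right t x)
  rw [h.fderiv]
  simp

lemma hasDerivAt_slice {E F : Type*} [NormedAddCommGroup E] [NormedSpace ℝ E]
    [NormedAddCommGroup F] [NormedSpace ℝ F] {w : ℝ → E → F} {t : ℝ} {x : E}
    (hw : DifferentiableAt ℝ (fun q : ℝ × E => w q.1 q.2) (t, x)) :
    HasDerivAt (fun s => w s x) (fderiv ℝ (fun q : ℝ × E => w q.1 q.2) (t, x) (1, 0)) t :=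
  HasFDerivAt.comp_hasDerivAt (l := fun q : ℝ × E => w q.1 q.2) t hw.hasFDerivAt
    ((hasDerivAt_id t).prodMk (hasDerivAt_const t x))

section SpaceTime

variable {d : ℕ} {w : ℝ → (Fin d → ℝ) → (Fin d → ℝ)}

lemma contDiff_vdiv (hw : ContDiff ℝ 2 (fun q : ℝ × (Fin d → ℝ) => w q.1 q.2)) :
    ContDiff ℝ 1 (fun q : ℝ × (Fin d → ℝ) => vdiv (w q.1) q.2) := by
  simp only [vdiv, fderiv_slice_apply (hw.differentiable (by simp) _)]
  exact ContDiff.sum fun i _ =>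
    contDiff_pi.1 ((hw.fderiv_right (by norm_num)).clm_apply contDiff_const) i

/-- The divergence commutes with the time derivative. -/
lemma hasDerivAt_vdiv (hw : ContDiff ℝ 2 (fun q : ℝ × (Fin d → ℝ) => w q.1 q.2)) (t : ℝ)
    (x : Fin d → ℝ) :
    HasDerivAt (fun s => vdiv (w s) x)
      (vdiv (fun x' i => deriv (fun s => w s x' i) t) x) t := by
  have hwd := hw.differentiable (by simp)
  have hD : Differentiable ℝ (fderiv ℝ (fun q : ℝ × (Fin d → ℝ) => w q.1 q.2)) :=
    (hw.fderiv_right (m := 1) (by norm_num)).differentiable (by simp)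
  have hsymm := (hw.contDiffAt (x := (t, x))).isSymmSndFDerivAt (by simp)
  have htime : (fun x' i => deriv (fun s => w s x' i) t) =
      fun x' => fderiv ℝ (fun q : ℝ × (Fin d → ℝ) => w q.1 q.2) (t, x') (1, 0) := by
    funext x' i
    exact (hasDerivAt_pi.1 (hasDerivAt_slice (hwd (t, x'))) i).deriv
  rw [htime]
  simp only [vdiv, fderiv_slice_apply (hwd _)]
  refine HasDerivAt.fun_sum fun i _ => ?_
  have h1 : HasFDerivAt
      (fun x' => fderiv ℝ (fun q : ℝ × (Fin d → ℝ) => w q.1 q.2) (t, x') (1, 0)) _ x :=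
    ((hD (t, x)).hasFDerivAt.comp x (hasFDerivAt_prodMk_right t x)).clm_apply
      (hasFDerivAt_const _ x)
  have h2 : HasDerivAt
      (fun s => fderiv ℝ (fun q : ℝ × (Fin d → ℝ) => w q.1 q.2) (s, x) (0, Pi.single i 1)) _ t :=
    (hasDerivAt_slice (w := fun s x => fderiv ℝ (fun q : ℝ × (Fin d → ℝ) => w q.1 q.2) (s, x))
      (hD (t, x))).clm_apply (hasDerivAt_const t _)
  rw [h1.fderiv]
  convert hasDerivAt_pi.1 h2 i using 1
  simpa using congrFun (hsymm.eq (0, Pi.single i 1) (1, 0)) i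

end SpaceTime

/-- **Energy equality for the Ramshaw–Mesina hybrid model (continuous case).**
For a classical compactly supported solution `(w, λ)` of
`w_t + (w·∇)w + (1/2)(div w)w − νΔw + ∇λ = f`,
`λ_t + 2β div(w_t) + α² div w = 0`, one has for every `t`:
`d/dt[(1/2)∫|w|² + (α⁻²/2)∫(λ + 2β div w)²] + ν∫|Dw|² + 2β∫(div w)² = ∫ f·w`. -/
theorem hybrid_model_energy_equality
    (d : ℕ) (hd : 1 ≤ d) (ν α β : ℝ) (hν : 0 < ν) (hα : 0 < α)
    (f : (Fin d → ℝ) → (Fin d → ℝ)) (hf : Continuous f)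
    (w : ℝ → (Fin d → ℝ) → (Fin d → ℝ)) (lam : ℝ → (Fin d → ℝ) → ℝ)
    (hw : ContDiff ℝ 2 (fun q : ℝ × (Fin d → ℝ) => w q.1 q.2))
    (hlam : ContDiff ℝ 2 (fun q : ℝ × (Fin d → ℝ) => lam q.1 q.2))
    (K : Set (Fin d → ℝ)) (hK : IsCompact K)
    (hsuppw : ∀ t : ℝ, Function.support (w t) ⊆ K)
    (hsupplam : ∀ t : ℝ, Function.support (lam t) ⊆ K)
    -- momentum equation, componentwise
    (hmom : ∀ (t : ℝ) (x : Fin d → ℝ) (i : Fin d),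
      deriv (fun s => w s x i) t + fderiv ℝ (w t) x (w t x) i
        + (1 / 2) * vdiv (w t) x * w t x i - ν * vlap (w t) x i
        + fderiv ℝ (lam t) x (Pi.single i 1) = f x i)
    -- hybrid continuity relaxation
    (hcont : ∀ (t : ℝ) (x : Fin d → ℝ),
      deriv (fun s => lam s x) t
        + 2 * β * vdiv (fun x' => fun i => deriv (fun s => w s x' i) t) x
        + α ^ 2 * vdiv (w t) x = 0) :
    ∀ t : ℝ,
      deriv (fun s =>
          (1 / 2) * (∫ x : Fin d → ℝ, ∑ i, (w s x i) ^ 2)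
            + ((α ^ 2)⁻¹ / 2) *
                (∫ x : Fin d → ℝ, (lam s x + 2 * β * vdiv (w s) x) ^ 2)) t
        + ν * (∫ x : Fin d → ℝ, frobSq (w t) x)
        + 2 * β * (∫ x : Fin d → ℝ, (vdiv (w t) x) ^ 2)
      = ∫ x : Fin d → ℝ, dotProd (f x) (w t x) := by
  intro t
  have hw0 : ∀ s, ∀ x ∉ K, w s x = 0 := fun s x hx =>
    Function.notMem_support.1 fun h => hx (hsuppw s h)
  have hl0 : ∀ s, ∀ x ∉ K, lam s x = 0 := fun s x hx =>
    Function.notMem_support.1 fun h => hx (hsupplam s h)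
  have hv0 : ∀ s, ∀ x ∉ K, vdiv (w s) x = 0 := fun s x hx =>
    vdiv_eq_zero_off hK.isClosed (hw0 s) hx
  have hwt : ContDiff ℝ 2 (w t) := hw.comp (contDiff_prodMk_right t)
  have hlt : ContDiff ℝ 2 (lam t) := hlam.comp (contDiff_prodMk_right t)
  have hw1 : ContDiff ℝ 1 (fun q : ℝ × (Fin d → ℝ) => w q.1 q.2) := hw.of_le (by norm_num)
  have hl1 : ContDiff ℝ 1 (fun q : ℝ × (Fin d → ℝ) => lam q.1 q.2) := hlam.of_le (by norm_num)
  have hwi : ∀ x i, HasDerivAt (fun s => w s x i) (deriv (fun s => w s x i) t) t := fun x i =>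
    (hasDerivAt_pi.1 (hasDerivAt_slice (hw1.differentiable (by simp) (t, x))) i)
      |>.differentiableAt.hasDerivAt
  have hli : ∀ x, HasDerivAt (fun s => lam s x) (deriv (fun s => lam s x) t) t := fun x =>
    (hasDerivAt_slice (hl1.differentiable (by simp) (t, x))).differentiableAt.hasDerivAt
  -- differentiate both parts of the energy under the integral sign
  have hkin : HasDerivAt (fun s => ∫ x : Fin d → ℝ, ∑ i, (w s x i) ^ 2)
      (∫ x, 2 * ∑ i, w t x i * deriv (fun s => w s x i) t) t := by
    refine hasDerivAt_integral_of_contDiff_of_eq_zero_off hK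
      (ContDiff.sum fun i _ => (contDiff_pi.1 hw1 i).pow 2)
      (fun s x hx => by simp [hw0 s x hx]) t fun x => ?_
    refine (HasDerivAt.fun_sum (u := Finset.univ) fun i _ => (hwi x i).fun_pow 2).congr_deriv ?_
    rw [Finset.mul_sum]
    exact Finset.sum_congr rfl fun i _ => by push_cast; ring
  have hpot : HasDerivAt (fun s => ∫ x : Fin d → ℝ, (lam s x + 2 * β * vdiv (w s) x) ^ 2)
      (∫ x, -(2 * α ^ 2) * ((lam t x + 2 * β * vdiv (w t) x) * vdiv (w t) x)) t := by
    refine hasDerivAt_integral_of_contDiff_of_eq_zero_off hK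
      ((hl1.add (contDiff_const.mul (contDiff_vdiv hw))).pow 2)
      (fun s x hx => by simp [hl0 s x hx, hv0 s x hx]) t fun x => ?_
    refine (((hli x).fun_add ((hasDerivAt_vdiv hw t x).const_mul (2 * β))).fun_pow 2).congr_deriv ?_
    have h := hcont t x
    push_cast
    linear_combination (2 * (lam t x + 2 * β * vdiv (w t) x)) * h
  rw [((hkin.const_mul (1 / 2)).fun_add (hpot.const_mul ((α ^ 2)⁻¹ / 2))).deriv,
    integral_const_mul, integral_const_mul]
  have hα2 : α ^ 2 ≠ 0 := by positivity
  have hcanc : (α ^ 2)⁻¹ / 2 * (-(2 * α ^ 2) *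
      ∫ x, (lam t x + 2 * β * vdiv (w t) x) * vdiv (w t) x) =
      -∫ x, (lam t x + 2 * β * vdiv (w t) x) * vdiv (w t) x := by
    field_simp
  rw [hcanc]
  -- continuity, hence integrability, of all the integrands
  have hvc : Continuous (vdiv (w t)) := continuous_vdiv (hwt.of_le (by norm_num))
  have hwc (i : Fin d) : Continuous fun x => w t x i := (contDiff_pi.1 hwt i).continuous
  have hflux1 := contDiff_energyFlux ν hwt hlt
  have hflux0 : ∀ x ∉ K, energyFlux ν (w t) (lam t) x = 0 := fun x hx => by
    funext j
    simp [energyFlux, hw0 t x hx]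
  have hfluxint := integrable_of_continuous_of_eq_zero_off hK (continuous_vdiv hflux1)
    fun x hx => vdiv_eq_zero_off hK.isClosed hflux0 hx
  have hfrobint : Integrable (frobSq (w t)) := integrable_of_continuous_of_eq_zero_off hK
    (continuous_finsetSum _ fun i _ => continuous_finsetSum _ fun j _ =>
      (contDiff_fderiv_apply_apply hwt _ i).continuous.pow 2)
    fun x hx => by simp [frobSq, fderiv_eq_zero_off hK.isClosed (hw0 t) hx]
  have hdivint : Integrable (fun x => vdiv (w t) x ^ 2) :=
    integrable_of_continuous_of_eq_zero_off hK (hvc.pow 2) fun x hx => by simp [hv0 t x hx]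
  have hpotint : Integrable (fun x => (lam t x + 2 * β * vdiv (w t) x) * vdiv (w t) x) :=
    integrable_of_continuous_of_eq_zero_off hK
      ((hlt.continuous.add (continuous_const.mul hvc)).mul hvc) fun x hx => by simp [hv0 t x hx]
  have hforce : Integrable (fun x => dotProd (f x) (w t x)) :=
    integrable_of_continuous_of_eq_zero_off hK
      (continuous_finsetSum _ fun i _ => ((continuous_apply i).comp hf).mul (hwc i))
      fun x hx => by simp [dotProd, hw0 t x hx]
  -- the momentum equation tested against `w`
  have hkey : ∀ x, ∑ i, w t x i * deriv (fun s => w s x i) t =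
      dotProd (f x) (w t x) - vdiv (energyFlux ν (w t) (lam t)) x - ν * frobSq (w t) x
        + (lam t x + 2 * β * vdiv (w t) x) * vdiv (w t) x - 2 * β * vdiv (w t) x ^ 2 := fun x => by
    have h : dotProd (f x) (w t x) = ∑ i, w t x i * deriv (fun s => w s x i) t +
        (vdiv (energyFlux ν (w t) (lam t)) x + ν * frobSq (w t) x - lam t x * vdiv (w t) x) := by
      rw [vdiv_energyFlux ν hwt hlt, ← Finset.sum_add_distrib]
      exact Finset.sum_congr rfl fun i _ => by rw [← hmom t x i]; ring
    rw [h]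
    ring
  simp only [hkey]
  have hint₁ : Integrable fun x =>
      dotProd (f x) (w t x) - vdiv (energyFlux ν (w t) (lam t)) x := hforce.sub hfluxint
  have hint₂ : Integrable fun x => dotProd (f x) (w t x) - vdiv (energyFlux ν (w t) (lam t)) x
      - ν * frobSq (w t) x := hint₁.sub (hfrobint.const_mul ν)
  have hint₃ : Integrable fun x => dotProd (f x) (w t x) - vdiv (energyFlux ν (w t) (lam t)) x
      - ν * frobSq (w t) x + (lam t x + 2 * β * vdiv (w t) x) * vdiv (w t) x :=
    hint₂.add hpotint
  rw [integral_sub hint₃ (hdivint.const_mul (2 * β)), integral_add hint₂ hpotint,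
    integral_sub hint₁ (hfrobint.const_mul ν), integral_sub hforce hfluxint,
    integral_vdiv_eq_zero hK hflux1 hflux0, integral_const_mul, integral_const_mul]
  ring
end

section
/- (Unconditional stability of the hybrid model, Theorem 4.1.) Let d ≥ 1, ν > 0, α > 0, β ≥ 0, T > 0, let f : ℝᵈ → ℝᵈ be continuous, and let (w, λ) be a classical compactly supported solution of the hybrid model: w : ℝ × ℝᵈ → ℝᵈ and λ : ℝ × ℝᵈ → ℝ are twice continuously differentiable jointly in (t, x), there is a compact set K ⊂ ℝᵈ with supp w(t,·) ⊆ K and supp λ(t,·) ⊆ K for every t, and for all (t, x): ∂_t w + (w·∇)w + (1/2)(div w)·w − νΔw + ∇λ = f and ∂_t λ + 2β·div(∂_t w) + α²·div w = 0. Suppose moreover C_f ≥ 0 is a constant such that ∫_{ℝᵈ} f·v dx ≤ C_f · (∫_{ℝᵈ}|Dv|² dx)^{1/2} for every continuously differentiable compactly supported vector field v : ℝᵈ → ℝᵈ (a bound on the H⁻¹-type dual norm of f). Then ∫_{ℝᵈ}|w(T,x)|² dx + α⁻²∫_{ℝᵈ}(λ(T,x) + 2β·div w(T,x))² dx + ∫₀ᵀ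 [ ν∫_{ℝᵈ}|Dw(t,x)|² dx + 4β∫_{ℝᵈ}(div w(t,x))² dx ] dt ≤ T·ν⁻¹·C_f² + ∫_{ℝᵈ}|w(0,x)|² dx + α⁻²∫_{ℝᵈ}(λ(0,x) + 2β·div w(0,x))² dx. -/
open MeasureTheory

section Slices

variable {d : ℕ} {F : Type*} [NormedAddCommGroup F] [NormedSpace ℝ F]

theorem fderiv_space_slice {g : ℝ × (Fin d → ℝ) → F} (hg : Differentiable ℝ g)
    (t : ℝ) (x v : Fin d → ℝ) :
    fderiv ℝ (fun y => g (t, y)) x v = fderiv ℝ g (t, x) (0, v) := by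
  have h : HasFDerivAt (fun y => g (t, y)) _ x :=
    (hg (t, x)).hasFDerivAt.comp x (hasFDerivAt_prodMk_right t x)
  simp [h.fderiv]

theorem hasDerivAt_time_slice {g : ℝ × (Fin d → ℝ) → F} (hg : Differentiable ℝ g)
    (t : ℝ) (x : Fin d → ℝ) :
    HasDerivAt (fun s => g (s, x)) (fderiv ℝ g (t, x) (1, 0)) t := by
  have h : HasFDerivAt (fun s => g (s, x)) _ t :=
    (hg (t, x)).hasFDerivAt.comp t (hasFDerivAt_prodMk_left t x)
  simpa using h.hasDerivAt

theorem fderiv_pi_component {g : (Fin d → ℝ) → (Fin d → ℝ)} {x : Fin d → ℝ}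
    (hg : DifferentiableAt ℝ g x) (v : Fin d → ℝ) (i : Fin d) :
    fderiv ℝ g x v i = fderiv ℝ (fun y => g y i) x v := by
  rw [fderiv_apply hg i]
  rfl

theorem ContDiff.fderiv_apply_const {E : Type*} [NormedAddCommGroup E] [NormedSpace ℝ E]
    {g : E → F} (hg : ContDiff ℝ 2 g) (v : E) :
    ContDiff ℝ 1 (fun q => fderiv ℝ g q v) :=
  (hg.fderiv_right (m := 1) (by norm_num)).clm_apply contDiff_const

theorem ContDiff.fderiv_fderiv_comm {E : Type*} [NormedAddCommGroup E] [NormedSpace ℝ E]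
    {g : E → F} (hg : ContDiff ℝ 2 g) (q v v' : E) :
    fderiv ℝ (fun p => fderiv ℝ g p v) q v' = fderiv ℝ (fun p => fderiv ℝ g p v') q v := by
  have hd : DifferentiableAt ℝ (fderiv ℝ g) q :=
    (hg.fderiv_right (m := 1) (by norm_num)).differentiable (by norm_num) q
  have hs : IsSymmSndFDerivAt ℝ g q := hg.contDiffAt.isSymmSndFDerivAt (by simp)
  rw [fderiv_clm_apply hd (differentiableAt_const v),
    fderiv_clm_apply hd (differentiableAt_const v')]
  simpa using hs v' v

theorem fderiv_eq_zero_of_vanish_off {g : ℝ × (Fin d → ℝ) → F} {K : Set (Fin d → ℝ)}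
    (hK : IsCompact K) (hg : ∀ t, ∀ x ∉ K, g (t, x) = 0) (t : ℝ) (x : Fin d → ℝ) (hx : x ∉ K) :
    fderiv ℝ g (t, x) = 0 := by
  have h : g =ᶠ[nhds (t, x)] fun _ => 0 := by
    have : (Set.univ ×ˢ Kᶜ : Set (ℝ × (Fin d → ℝ))) ∈ nhds (t, x) :=
      (isOpen_univ.prod hK.isClosed.isOpen_compl).mem_nhds ⟨trivial, hx⟩
    filter_upwards [this] with p hp using hg p.1 p.2 hp.2
  rw [h.fderiv_eq]
  simp

end Slices

section CompactSupport

variable {d : ℕ} {g : ℝ × (Fin d → ℝ) → ℝ} {K : Set (Fin d → ℝ)}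

theorem integrable_space_slice (hK : IsCompact K) (hc : Continuous g)
    (hg : ∀ t, ∀ x ∉ K, g (t, x) = 0) (t : ℝ) : Integrable (fun x => g (t, x)) :=
  (hc.comp (by fun_prop : Continuous fun x : Fin d → ℝ => (t, x))).integrable_of_hasCompactSupport
    (HasCompactSupport.intro hK (hg t))

theorem continuous_integral_space_slice (hK : IsCompact K) (hc : Continuous g)
    (hg : ∀ t, ∀ x ∉ K, g (t, x) = 0) : Continuous fun t => ∫ x, g (t, x) := by
  rw [← continuousOn_univ]
  exact continuousOn_integral_of_compact_support hK (f := fun t x => g (t, x)) hc.continuousOn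
    fun t x _ => hg t x

theorem integral_space_fderiv_eq_zero (hK : IsCompact K) (hc : ContDiff ℝ 1 g)
    (hg : ∀ t, ∀ x ∉ K, g (t, x) = 0) (t : ℝ) (v : Fin d → ℝ) :
    ∫ x, fderiv ℝ g (t, x) (0, v) = 0 := by
  have hd : Differentiable ℝ g := hc.differentiable (by norm_num)
  have hi : Integrable fun x => fderiv ℝ g (t, x) (0, v) :=
    integrable_space_slice hK ((hc.continuous_fderiv (by norm_num)).clm_apply continuous_const)
      (fun t x hx => by simp [fderiv_eq_zero_of_vanish_off hK hg t x hx]) t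
  have h := integral_mul_fderiv_eq_neg_fderiv_mul_of_integrable (μ := volume)
    (f := fun _ : Fin d → ℝ => (1 : ℝ)) (g := fun x => g (t, x)) (v := v) (by simp)
    (by simpa [fderiv_space_slice hd] using hi)
    (by simpa using integrable_space_slice hK hc.continuous hg t)
    (fun _ _ => differentiableAt_const _)
    (fun x _ => by
      have : Differentiable ℝ fun x => g (t, x) := by fun_prop
      exact this x)
  simpa [fderiv_space_slice hd] using h

theorem integral_sub_integral_eq_intervalIntegral (hK : IsCompact K) (hc : ContDiff ℝ 1 g)
    (hg : ∀ t, ∀ x ∉ K, g (t, x) = 0) (a b : ℝ) :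
    (∫ x, g (b, x)) - ∫ x, g (a, x) = ∫ t in a..b, ∫ x, fderiv ℝ g (t, x) (1, 0) := by
  have hd : Differentiable ℝ g := hc.differentiable (by norm_num)
  have hc' : Continuous fun q => fderiv ℝ g q (1, 0) :=
    (hc.continuous_fderiv (by norm_num)).clm_apply continuous_const
  have hz : ∀ t, ∀ x ∉ K, fderiv ℝ g (t, x) (1, 0) = 0 := fun t x hx => by
    simp [fderiv_eq_zero_of_vanish_off hK hg t x hx]
  rw [← integral_sub (integrable_space_slice hK hc.continuous hg b)
    (integrable_space_slice hK hc.continuous hg a), intervalIntegral_integral_swap]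
  · congr 1 with x
    rw [intervalIntegral.integral_eq_sub_of_hasDerivAt
      (fun t _ => hasDerivAt_time_slice hd t x)]
    exact (hc'.comp (by fun_prop : Continuous fun t : ℝ => (t, x))).intervalIntegrable _ _
  · have hcomp : IntegrableOn (fun q => fderiv ℝ g q (1, 0)) (Set.uIcc a b ×ˢ K)
        ((volume : Measure ℝ).prod (volume : Measure (Fin d → ℝ))) :=
      hc'.continuousOn.integrableOn_compact (isCompact_uIcc.prod hK)
    have hall : IntegrableOn (fun q => fderiv ℝ g q (1, 0)) (Set.uIcc a b ×ˢ Set.univ)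
        ((volume : Measure ℝ).prod (volume : Measure (Fin d → ℝ))) :=
      hcomp.of_forall_sdiff_eq_zero (measurableSet_uIcc.prod MeasurableSet.univ)
        fun q hq => hz q.1 q.2 fun hK' => hq.2 ⟨hq.1.1, hK'⟩
    have := hall.mono_set (Set.prod_mono Set.uIoc_subset_uIcc subset_rfl)
    rw [IntegrableOn, ← Measure.prod_restrict, Measure.restrict_univ] at this
    exact this

end CompactSupport

section EnergyIdentity

variable {ι V : Type*} [Fintype ι] [NormedAddCommGroup V] [NormedSpace ℝ V]

/-- The sum of the directional derivatives of the components `u i` along the directions `e i`. -/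
noncomputable def dirDiv (e : ι → V) (u : ι → V → ℝ) (q : V) : ℝ :=
  ∑ i, fderiv ℝ (u i) q (e i)

/-- The density `|u|² + α⁻² (l + 2β div u)²` of the energy controlled by the hybrid model. -/
noncomputable def hybridEnergyDensity (α β : ℝ) (e : ι → V) (u : ι → V → ℝ) (l : V → ℝ)
    (q : V) : ℝ :=
  ∑ i, u i q ^ 2 + (α ^ 2)⁻¹ * (l q + 2 * β * dirDiv e u q) ^ 2

/-- The `j`-th component of the energy flux `l u + |u|² u / 2 - ν ∇|u|² / 2`. -/
noncomputable def hybridEnergyFlux (ν : ℝ) (e : ι → V) (u : ι → V → ℝ) (l : V → ℝ) (j : ι)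
    (q : V) : ℝ :=
  l q * u j q + (1 / 2) * ((∑ i, u i q ^ 2) * u j q)
    - ν * ∑ i, u i q * fderiv ℝ (u i) q (e j)

variable {e : ι → V} {u : ι → V → ℝ} {l : V → ℝ}

theorem contDiff_dirDiv (hu : ∀ i, ContDiff ℝ 2 (u i)) : ContDiff ℝ 1 (dirDiv e u) :=
  ContDiff.sum fun i _ => (hu i).fderiv_apply_const (e i)

theorem contDiff_hybridEnergyDensity (α β : ℝ) (hu : ∀ i, ContDiff ℝ 2 (u i))
    (hl : ContDiff ℝ 1 l) : ContDiff ℝ 1 (hybridEnergyDensity α β e u l) := by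
  have hu' : ∀ i, ContDiff ℝ 1 (u i) := fun i => (hu i).of_le (by norm_num)
  exact (ContDiff.sum fun i _ => (hu' i).pow 2).add
    (contDiff_const.mul ((hl.add (contDiff_const.mul (contDiff_dirDiv hu))).pow 2))

theorem contDiff_hybridEnergyFlux (ν : ℝ) (hu : ∀ i, ContDiff ℝ 2 (u i))
    (hl : ContDiff ℝ 1 l) (j : ι) : ContDiff ℝ 1 (hybridEnergyFlux ν e u l j) := by
  have hu' : ∀ i, ContDiff ℝ 1 (u i) := fun i => (hu i).of_le (by norm_num)
  exact ((hl.mul (hu' j)).add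
    (contDiff_const.mul ((ContDiff.sum fun i _ => (hu' i).pow 2).mul (hu' j)))).sub
    (contDiff_const.mul (ContDiff.sum fun i _ => (hu' i).mul ((hu i).fderiv_apply_const (e j))))

theorem fderiv_hybridEnergyDensity (α β : ℝ) (hu : ∀ i, ContDiff ℝ 2 (u i))
    (hl : ContDiff ℝ 1 l) (q v : V) :
    fderiv ℝ (hybridEnergyDensity α β e u l) q v =
      2 * ∑ i, u i q * fderiv ℝ (u i) q v
      + 2 * (α ^ 2)⁻¹ * (l q + 2 * β * dirDiv e u q) * (fderiv ℝ l q v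
        + 2 * β * ∑ i, fderiv ℝ (fun p => fderiv ℝ (u i) p v) q (e i)) := by
  have du : ∀ i, HasFDerivAt (u i) (fderiv ℝ (u i) q) q := fun i =>
    ((hu i).differentiable (by norm_num) q).hasFDerivAt
  have dl : HasFDerivAt l (fderiv ℝ l q) q := (hl.differentiable (by norm_num) q).hasFDerivAt
  have ddu : ∀ i, HasFDerivAt (fun p => fderiv ℝ (u i) p (e i)) _ q := fun i =>
    (((hu i).fderiv_apply_const (e i)).differentiable (by norm_num) q).hasFDerivAt
  have hdiv : HasFDerivAt (dirDiv e u) _ q := HasFDerivAt.fun_sum fun i _ => ddu i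
  have h : HasFDerivAt (hybridEnergyDensity α β e u l) _ q :=
    (HasFDerivAt.fun_sum fun i (_ : i ∈ Finset.univ) => (du i).pow 2).add
      (((dl.add (hdiv.const_mul (2 * β))).pow 2).const_mul (α ^ 2)⁻¹)
  rw [h.fderiv]
  simp_rw [fun i => (hu i).fderiv_fderiv_comm q v (e i)]
  have h2 : ∑ i, 2 * (u i q * fderiv ℝ (u i) q v) = 2 * ∑ i, u i q * fderiv ℝ (u i) q v :=
    (Finset.mul_sum ..).symm
  simp [mul_assoc, h2]
  ring

theorem fderiv_hybridEnergyFlux (ν : ℝ) (hu : ∀ i, ContDiff ℝ 2 (u i))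
    (hl : ContDiff ℝ 1 l) (j : ι) (q v : V) :
    fderiv ℝ (hybridEnergyFlux ν e u l j) q v =
      fderiv ℝ l q v * u j q + l q * fderiv ℝ (u j) q v
      + (∑ i, u i q * fderiv ℝ (u i) q v) * u j q
      + (1 / 2) * (∑ i, u i q ^ 2) * fderiv ℝ (u j) q v
      - ν * ∑ i, fderiv ℝ (u i) q v * fderiv ℝ (u i) q (e j)
      - ν * ∑ i, u i q * fderiv ℝ (fun p => fderiv ℝ (u i) p (e j)) q v := by
  have du : ∀ i, HasFDerivAt (u i) (fderiv ℝ (u i) q) q := fun i =>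
    ((hu i).differentiable (by norm_num) q).hasFDerivAt
  have dl : HasFDerivAt l (fderiv ℝ l q) q := (hl.differentiable (by norm_num) q).hasFDerivAt
  have ddu : ∀ i, HasFDerivAt (fun p => fderiv ℝ (u i) p (e j)) _ q := fun i =>
    (((hu i).fderiv_apply_const (e j)).differentiable (by norm_num) q).hasFDerivAt
  have h : HasFDerivAt (hybridEnergyFlux ν e u l j) _ q :=
    ((dl.mul (du j)).add (((HasFDerivAt.fun_sum fun i (_ : i ∈ Finset.univ) =>
      (du i).pow 2).mul (du j)).const_mul (1 / 2))).sub
      ((HasFDerivAt.fun_sum fun i (_ : i ∈ Finset.univ) => (du i).mul (ddu i)).const_mul ν)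
  rw [h.fderiv]
  have h2 : ∑ i, 2 * (u i q * fderiv ℝ (u i) q v) = 2 * ∑ i, u i q * fderiv ℝ (u i) q v :=
    (Finset.mul_sum ..).symm
  simp [Finset.sum_add_distrib, mul_assoc, h2]
  simp_rw [mul_comm (fderiv ℝ (u _) q v)]
  ring

theorem sum_fderiv_hybridEnergyFlux (ν : ℝ) (hu : ∀ i, ContDiff ℝ 2 (u i))
    (hl : ContDiff ℝ 1 l) (q : V) :
    ∑ j, fderiv ℝ (hybridEnergyFlux ν e u l j) q (e j) =
      ∑ i, u i q * (∑ j, u j q * fderiv ℝ (u i) q (e j) + (1 / 2) * dirDiv e u q * u i q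
        - ν * ∑ j, fderiv ℝ (fun p => fderiv ℝ (u i) p (e j)) q (e j) + fderiv ℝ l q (e i))
      + l q * dirDiv e u q - ν * ∑ i, ∑ j, fderiv ℝ (u i) q (e j) ^ 2 := by
  have h1 : ∑ j, (∑ i, u i q * fderiv ℝ (u i) q (e j)) * u j q =
      ∑ i, u i q * ∑ j, u j q * fderiv ℝ (u i) q (e j) := by
    simp_rw [Finset.sum_mul, Finset.mul_sum]
    rw [Finset.sum_comm]
    exact Finset.sum_congr rfl fun i _ => Finset.sum_congr rfl fun j _ => by ring
  have h2 : ∑ j, ∑ i, u i q * fderiv ℝ (fun p => fderiv ℝ (u i) p (e j)) q (e j) =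
      ∑ i, u i q * ∑ j, fderiv ℝ (fun p => fderiv ℝ (u i) p (e j)) q (e j) := by
    simp_rw [Finset.mul_sum]
    exact Finset.sum_comm
  have h3 : ∑ i, u i q * ((1 / 2) * dirDiv e u q * u i q) =
      (1 / 2) * (∑ i, u i q ^ 2) * dirDiv e u q := by
    simp_rw [Finset.mul_sum, Finset.sum_mul]
    exact Finset.sum_congr rfl fun i _ => by ring
  have h4 : ∑ i, u i q * (ν * ∑ j, fderiv ℝ (fun p => fderiv ℝ (u i) p (e j)) q (e j)) =
      ν * ∑ i, u i q * ∑ j, fderiv ℝ (fun p => fderiv ℝ (u i) p (e j)) q (e j) := by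
    rw [Finset.mul_sum]
    exact Finset.sum_congr rfl fun i _ => by ring
  have h5 : ∑ j, fderiv ℝ l q (e j) * u j q = ∑ i, u i q * fderiv ℝ l q (e i) :=
    Finset.sum_congr rfl fun i _ => mul_comm _ _
  simp_rw [fderiv_hybridEnergyFlux ν hu hl, mul_add, mul_sub, mul_add,
    Finset.sum_sub_distrib, Finset.sum_add_distrib, Finset.sum_sub_distrib,
    Finset.sum_add_distrib, ← Finset.mul_sum]
  rw [h1, h2, h3, h4, h5, Finset.sum_comm (f := fun j i => fderiv ℝ (u i) q (e j) *
    fderiv ℝ (u i) q (e j))]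
  simp_rw [← sq]
  rw [dirDiv]
  ring

theorem fderiv_hybridEnergyDensity_of_solution {ν α β : ℝ} (hα : α ≠ 0)
    (hu : ∀ i, ContDiff ℝ 2 (u i)) (hl : ContDiff ℝ 1 l) {q τ : V} {φ : ι → ℝ}
    (hmom : ∀ i, fderiv ℝ (u i) q τ + ∑ j, u j q * fderiv ℝ (u i) q (e j)
      + (1 / 2) * dirDiv e u q * u i q
      - ν * ∑ j, fderiv ℝ (fun p => fderiv ℝ (u i) p (e j)) q (e j)
      + fderiv ℝ l q (e i) = φ i)
    (hcont : fderiv ℝ l q τ + 2 * β * ∑ i, fderiv ℝ (fun p => fderiv ℝ (u i) p τ) q (e i)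
      + α ^ 2 * dirDiv e u q = 0) :
    fderiv ℝ (hybridEnergyDensity α β e u l) q τ =
      2 * ∑ i, φ i * u i q - 2 * ∑ j, fderiv ℝ (hybridEnergyFlux ν e u l j) q (e j)
      - 2 * (ν * ∑ i, ∑ j, fderiv ℝ (u i) q (e j) ^ 2) - 4 * β * dirDiv e u q ^ 2 := by
  have hφ : ∑ i, φ i * u i q = ∑ i, u i q * fderiv ℝ (u i) q τ
      + ∑ i, u i q * (∑ j, u j q * fderiv ℝ (u i) q (e j) + (1 / 2) * dirDiv e u q * u i q
        - ν * ∑ j, fderiv ℝ (fun p => fderiv ℝ (u i) p (e j)) q (e j)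
        + fderiv ℝ l q (e i)) := by
    rw [← Finset.sum_add_distrib]
    exact Finset.sum_congr rfl fun i _ => by rw [← hmom i]; ring
  rw [fderiv_hybridEnergyDensity α β hu hl, sum_fderiv_hybridEnergyFlux ν hu hl, hφ,
    eq_neg_of_add_eq_zero_left hcont]
  field_simp
  ring

end EnergyIdentity

section EnergyInequality

variable {d : ℕ}

/-- The `j`-th spatial coordinate direction in space-time. -/
def spaceDir (j : Fin d) : ℝ × (Fin d → ℝ) := (0, Pi.single j 1)

/-- The energy inequality for the hybrid model written in terms of space-time derivatives. -/
theorem hybridEnergy_inequality {ν α β T C : ℝ} (hν : 0 < ν) (hα : 0 < α) (hT : 0 ≤ T)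
    {f : (Fin d → ℝ) → (Fin d → ℝ)} (hf : Continuous f)
    {u : Fin d → ℝ × (Fin d → ℝ) → ℝ} {l : ℝ × (Fin d → ℝ) → ℝ}
    (hu : ∀ i, ContDiff ℝ 2 (u i)) (hl : ContDiff ℝ 1 l)
    {K : Set (Fin d → ℝ)} (hK : IsCompact K)
    (hu0 : ∀ i t, ∀ x ∉ K, u i (t, x) = 0) (hl0 : ∀ t, ∀ x ∉ K, l (t, x) = 0)
    (hmom : ∀ t x i, fderiv ℝ (u i) (t, x) (1, 0)
      + ∑ j, u j (t, x) * fderiv ℝ (u i) (t, x) (spaceDir j)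
      + (1 / 2) * dirDiv spaceDir u (t, x) * u i (t, x)
      - ν * ∑ j, fderiv ℝ (fun p => fderiv ℝ (u i) p (spaceDir j)) (t, x) (spaceDir j)
      + fderiv ℝ l (t, x) (spaceDir i) = f x i)
    (hcont : ∀ t x, fderiv ℝ l (t, x) (1, 0)
      + 2 * β * ∑ i, fderiv ℝ (fun p => fderiv ℝ (u i) p (1, 0)) (t, x) (spaceDir i)
      + α ^ 2 * dirDiv spaceDir u (t, x) = 0)
    (hforce : ∀ t, ∫ x, ∑ i, f x i * u i (t, x) ≤
      C * √(∫ x, ∑ i, ∑ j, fderiv ℝ (u i) (t, x) (spaceDir j) ^ 2)) :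
    (∫ x, hybridEnergyDensity α β spaceDir u l (T, x))
      + (∫ t in (0 : ℝ)..T,
          (ν * (∫ x, ∑ i, ∑ j, fderiv ℝ (u i) (t, x) (spaceDir j) ^ 2)
            + 4 * β * ∫ x, dirDiv spaceDir u (t, x) ^ 2))
    ≤ T * ν⁻¹ * C ^ 2 + ∫ x, hybridEnergyDensity α β spaceDir u l (0, x) := by
  have hDu0 : ∀ i t, ∀ x ∉ K, fderiv ℝ (u i) (t, x) = 0 := fun i =>
    fderiv_eq_zero_of_vanish_off hK (hu0 i)
  have hdiv0 : ∀ t, ∀ x ∉ K, dirDiv spaceDir u (t, x) = 0 := fun t x hx => by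
    simp [dirDiv, hDu0 _ t x hx]
  have hE0 : ∀ t, ∀ x ∉ K, hybridEnergyDensity α β spaceDir u l (t, x) = 0 := fun t x hx => by
    simp [hybridEnergyDensity, hu0 _ t x hx, hl0 t x hx, hdiv0 t x hx]
  have hF0 : ∀ j t, ∀ x ∉ K, hybridEnergyFlux ν spaceDir u l j (t, x) = 0 := fun j t x hx => by
    simp [hybridEnergyFlux, hu0 _ t x hx]
  have hDuc : ∀ i v, Continuous fun q => fderiv ℝ (u i) q v := fun i v =>
    ((hu i).fderiv_apply_const v).continuous
  have hdivc : Continuous (dirDiv spaceDir u) := (contDiff_dirDiv hu).continuous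
  let D : ℝ × (Fin d → ℝ) → ℝ := fun q => ∑ i, ∑ j, fderiv ℝ (u i) q (spaceDir j) ^ 2
  have hDc : Continuous D := continuous_finsetSum _ fun i _ => continuous_finsetSum _ fun j _ =>
    (hDuc i (spaceDir j)).pow 2
  have hD0 : ∀ t, ∀ x ∉ K, D (t, x) = 0 := fun t x hx => by simp [D, hDu0 _ t x hx]
  let G : ℝ × (Fin d → ℝ) → ℝ := fun q => dirDiv spaceDir u q ^ 2
  have hGc : Continuous G := hdivc.pow 2
  have hG0 : ∀ t, ∀ x ∉ K, G (t, x) = 0 := fun t x hx => by simp [G, hdiv0 t x hx]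
  have hE1 : ContDiff ℝ 1 (hybridEnergyDensity α β spaceDir u l) :=
    contDiff_hybridEnergyDensity α β hu hl
  have hEt0 : ∀ t, ∀ x ∉ K, fderiv ℝ (hybridEnergyDensity α β spaceDir u l) (t, x) (1, 0) = 0 :=
    fun t x hx => by simp [fderiv_eq_zero_of_vanish_off hK hE0 t x hx]
  have hEtc : Continuous fun q => fderiv ℝ (hybridEnergyDensity α β spaceDir u l) q (1, 0) :=
    (hE1.continuous_fderiv (by norm_num)).clm_apply continuous_const
  have hrate : ∀ t, ∫ x, fderiv ℝ (hybridEnergyDensity α β spaceDir u l) (t, x) (1, 0) =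
      2 * (∫ x, ∑ i, f x i * u i (t, x)) - 2 * (ν * ∫ x, D (t, x)) - 4 * β * ∫ x, G (t, x) := by
    intro t
    have hpt : ∀ x, fderiv ℝ (hybridEnergyDensity α β spaceDir u l) (t, x) (1, 0) =
        2 * (∑ i, f x i * u i (t, x))
          - 2 * ∑ j, fderiv ℝ (hybridEnergyFlux ν spaceDir u l j) (t, x) (spaceDir j)
          - 2 * (ν * D (t, x)) - 4 * β * G (t, x) := fun x =>
      fderiv_hybridEnergyDensity_of_solution hα.ne' hu hl (hmom t x) (hcont t x)
    have hFi : ∀ j, Integrable fun x =>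
        fderiv ℝ (hybridEnergyFlux ν spaceDir u l j) (t, x) (spaceDir j) :=
      fun j => integrable_space_slice hK
        (((contDiff_hybridEnergyFlux ν hu hl j).continuous_fderiv (by norm_num)).clm_apply
          continuous_const)
        (fun t x hx => by simp [fderiv_eq_zero_of_vanish_off hK (hF0 j) t x hx]) t
    have hflux : ∫ x, ∑ j,
        fderiv ℝ (hybridEnergyFlux ν spaceDir u l j) (t, x) (spaceDir j) = 0 := by
      rw [integral_finsetSum _ fun j _ => hFi j]
      exact Finset.sum_eq_zero fun j _ => integral_space_fderiv_eq_zero hK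
        (contDiff_hybridEnergyFlux ν hu hl j) (hF0 j) t _
    have hfi : Integrable fun x => ∑ i, f x i * u i (t, x) := by
      have huc : ∀ i, Continuous (u i) := fun i => (hu i).continuous
      refine integrable_space_slice (g := fun q => ∑ i, f q.2 i * u i q) hK (by fun_prop)
        (fun t x hx => by simp [hu0 _ t x hx]) t
    have hDi := integrable_space_slice hK hDc hD0 t
    have hGi := integrable_space_slice hK hGc hG0 t
    have hFs := integrable_finsetSum Finset.univ fun j _ => hFi j
    simp_rw [hpt]
    have hfF : Integrable fun x => 2 * (∑ i, f x i * u i (t, x))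
        - 2 * ∑ j, fderiv ℝ (hybridEnergyFlux ν spaceDir u l j) (t, x) (spaceDir j) :=
      (hfi.const_mul 2).sub (hFs.const_mul 2)
    have hfFD : Integrable fun x => 2 * (∑ i, f x i * u i (t, x))
        - 2 * ∑ j, fderiv ℝ (hybridEnergyFlux ν spaceDir u l j) (t, x) (spaceDir j)
        - 2 * (ν * D (t, x)) :=
      hfF.sub ((hDi.const_mul ν).const_mul 2)
    rw [integral_sub hfFD (hGi.const_mul _), integral_sub hfF ((hDi.const_mul ν).const_mul 2),
      integral_sub (hfi.const_mul 2) (hFs.const_mul 2)]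
    simp only [integral_const_mul, hflux]
    ring
  have hyoung : ∀ t, 2 * (∫ x, ∑ i, f x i * u i (t, x)) ≤ ν⁻¹ * C ^ 2 + ν * ∫ x, D (t, x) := by
    intro t
    have hs := Real.sq_sqrt (show 0 ≤ ∫ x, D (t, x) from integral_nonneg fun x => by positivity)
    have hsq : ν⁻¹ * (C - ν * √(∫ x, D (t, x))) ^ 2 = ν⁻¹ * C ^ 2
        + ν * √(∫ x, D (t, x)) ^ 2 - 2 * (C * √(∫ x, D (t, x))) := by
      field_simp
      ring
    have hnonneg : 0 ≤ ν⁻¹ * (C - ν * √(∫ x, D (t, x))) ^ 2 := by positivity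
    rw [hsq, hs] at hnonneg
    linarith [hforce t]
  have hDI := continuous_integral_space_slice hK hDc hD0
  have hGI := continuous_integral_space_slice hK hGc hG0
  have hdiss : Continuous fun t => ν * (∫ x, D (t, x)) + 4 * β * ∫ x, G (t, x) := by fun_prop
  have hmono : ∫ t in (0 : ℝ)..T, ∫ x,
      fderiv ℝ (hybridEnergyDensity α β spaceDir u l) (t, x) (1, 0) ≤
      ∫ t in (0 : ℝ)..T,
        (ν⁻¹ * C ^ 2 - (ν * (∫ x, D (t, x)) + 4 * β * ∫ x, G (t, x))) := by
    refine intervalIntegral.integral_mono_on hT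
      ((continuous_integral_space_slice hK hEtc hEt0).intervalIntegrable _ _)
      ((continuous_const.sub hdiss).intervalIntegrable _ _) fun t _ => ?_
    rw [hrate t]
    linarith [hyoung t]
  rw [← integral_sub_integral_eq_intervalIntegral hK hE1 hE0,
    intervalIntegral.integral_sub intervalIntegrable_const (hdiss.intervalIntegrable _ _),
    intervalIntegral.integral_const, smul_eq_mul, sub_zero] at hmono
  simp only [D, G] at hmono
  linarith

end EnergyInequality

/-- **Unconditional stability of the Ramshaw–Mesina hybrid model (Theorem 4.1).**
For a classical compactly supported solution `(w, λ)` of the hybrid model and a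
bound `C_f` on the `H⁻¹`-type dual norm of the body force `f`, one has
`∫|w(T)|² + α⁻²∫(λ(T) + 2β div w(T))² + ∫₀ᵀ [ν∫|Dw|² + 4β∫(div w)²] dt`
`≤ T ν⁻¹ C_f² + ∫|w(0)|² + α⁻²∫(λ(0) + 2β div w(0))²`. -/
theorem hybrid_model_unconditional_stability
    (d : ℕ) (hd : 1 ≤ d) (ν α β T : ℝ) (hν : 0 < ν) (hα : 0 < α) (hβ : 0 ≤ β)
    (hT : 0 < T)
    (f : (Fin d → ℝ) → (Fin d → ℝ)) (hf : Continuous f)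
    (w : ℝ → (Fin d → ℝ) → (Fin d → ℝ)) (lam : ℝ → (Fin d → ℝ) → ℝ)
    (hw : ContDiff ℝ 2 (fun q : ℝ × (Fin d → ℝ) => w q.1 q.2))
    (hlam : ContDiff ℝ 2 (fun q : ℝ × (Fin d → ℝ) => lam q.1 q.2))
    (K : Set (Fin d → ℝ)) (hK : IsCompact K)
    (hsuppw : ∀ t : ℝ, Function.support (w t) ⊆ K)
    (hsupplam : ∀ t : ℝ, Function.support (lam t) ⊆ K)
    -- momentum equation, componentwise
    (hmom : ∀ (t : ℝ) (x : Fin d → ℝ) (i : Fin d),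
      deriv (fun s => w s x i) t + fderiv ℝ (w t) x (w t x) i
        + (1 / 2) * vdiv (w t) x * w t x i - ν * vlap (w t) x i
        + fderiv ℝ (lam t) x (Pi.single i 1) = f x i)
    -- hybrid continuity relaxation
    (hcont : ∀ (t : ℝ) (x : Fin d → ℝ),
      deriv (fun s => lam s x) t
        + 2 * β * vdiv (fun x' => fun i => deriv (fun s => w s x' i) t) x
        + α ^ 2 * vdiv (w t) x = 0)
    -- dual-norm bound on the body force
    (C_f : ℝ) (hCf : 0 ≤ C_f)
    (hfdual : ∀ v : (Fin d → ℝ) → (Fin d → ℝ), ContDiff ℝ 1 v →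
      HasCompactSupport v →
      (∫ x : Fin d → ℝ, dotProd (f x) (v x)) ≤
        C_f * Real.sqrt (∫ x : Fin d → ℝ, frobSq v x)) :
    (∫ x : Fin d → ℝ, ∑ i, (w T x i) ^ 2)
      + (α ^ 2)⁻¹ * (∫ x : Fin d → ℝ, (lam T x + 2 * β * vdiv (w T) x) ^ 2)
      + (∫ t in (0 : ℝ)..T,
          (ν * (∫ x : Fin d → ℝ, frobSq (w t) x)
            + 4 * β * (∫ x : Fin d → ℝ, (vdiv (w t) x) ^ 2)))
    ≤ T * ν⁻¹ * C_f ^ 2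
      + (∫ x : Fin d → ℝ, ∑ i, (w 0 x i) ^ 2)
      + (α ^ 2)⁻¹ * (∫ x : Fin d → ℝ, (lam 0 x + 2 * β * vdiv (w 0) x) ^ 2) := by
  have hu2 : ∀ i, ContDiff ℝ 2 (fun q : ℝ × (Fin d → ℝ) => w q.1 q.2 i) := fun i =>
    contDiff_pi.1 hw i
  have hl1 : ContDiff ℝ 1 (fun q : ℝ × (Fin d → ℝ) => lam q.1 q.2) := hlam.of_le (by norm_num)
  set u : Fin d → ℝ × (Fin d → ℝ) → ℝ := fun i q => w q.1 q.2 i with hu_def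
  set l : ℝ × (Fin d → ℝ) → ℝ := fun q => lam q.1 q.2
  have du : ∀ i, Differentiable ℝ (u i) := fun i => (hu2 i).differentiable (by norm_num)
  have dl : Differentiable ℝ l := hl1.differentiable (by norm_num)
  have hwt : ∀ t, ContDiff ℝ 2 (w t) := fun t =>
    hw.comp (by fun_prop : ContDiff ℝ 2 fun x : Fin d → ℝ => (t, x))
  have hDw : ∀ t x v i, fderiv ℝ (w t) x v i = fderiv ℝ (u i) (t, x) (0, v) := fun t x v i => by
    rw [fderiv_pi_component ((hwt t).differentiable (by norm_num) x), ← fderiv_space_slice (du i)]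
  have hdiv : ∀ t x, vdiv (w t) x = dirDiv spaceDir u (t, x) := fun t x => by
    simp only [vdiv, dirDiv, hDw, spaceDir]
  have hfrob : ∀ t x, frobSq (w t) x = ∑ i, ∑ j, fderiv ℝ (u i) (t, x) (spaceDir j) ^ 2 :=
    fun t x => by simp only [frobSq, hDw, spaceDir]
  have hlap : ∀ t x i, vlap (w t) x i =
      ∑ j, fderiv ℝ (fun p => fderiv ℝ (u i) p (spaceDir j)) (t, x) (spaceDir j) := fun t x i => by
    simp only [vlap, hDw]
    exact Finset.sum_congr rfl fun j _ => fderiv_space_slice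
      (((hu2 i).fderiv_apply_const (spaceDir j)).differentiable (by norm_num)) t x _
  have hconv : ∀ t x i, fderiv ℝ (w t) x (w t x) i =
      ∑ j, u j (t, x) * fderiv ℝ (u i) (t, x) (spaceDir j) := fun t x i => by
    have hexp : fderiv ℝ (w t) x (w t x) =
        ∑ j, w t x j • fderiv ℝ (w t) x (Pi.single j 1) := by
      conv_lhs => rw [pi_eq_sum_univ' (w t x)]
      simp only [map_sum, map_smul]
    rw [hexp]
    simp only [Finset.sum_apply, Pi.smul_apply, smul_eq_mul, hDw]
    rfl
  have htime : ∀ t x i, deriv (fun s => w s x i) t = fderiv ℝ (u i) (t, x) (1, 0) :=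
    fun t x i => (hasDerivAt_time_slice (du i) t x).deriv
  have htimediv : ∀ t x, vdiv (fun x' => fun i => deriv (fun s => w s x' i) t) x =
      ∑ i, fderiv ℝ (fun p => fderiv ℝ (u i) p (1, 0)) (t, x) (spaceDir i) := fun t x => by
    have hs : ∀ i, Differentiable ℝ fun p => fderiv ℝ (u i) p (1, 0) := fun i =>
      ((hu2 i).fderiv_apply_const _).differentiable (by norm_num)
    simp only [vdiv, htime]
    refine Finset.sum_congr rfl fun i _ => ?_
    rw [fderiv_pi_component]
    · exact fderiv_space_slice (hs i) t x _
    exact differentiableAt_pi.2 fun i =>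
      ((hs i).comp (by fun_prop : Differentiable ℝ fun y : Fin d → ℝ => (t, y))) x
  have hu0 : ∀ i t, ∀ x ∉ K, u i (t, x) = 0 := fun i t x hx => by
    have : w t x = 0 := by_contra fun h => hx (hsuppw t h)
    simp [hu_def, this]
  have hl0 : ∀ t, ∀ x ∉ K, l (t, x) = 0 := fun t x hx => by_contra fun h => hx (hsupplam t h)
  have hineq := hybridEnergy_inequality (C := C_f) hν hα hT.le hf hu2 hl1 hK hu0 hl0
    (fun t x i => by
      have := hmom t x i
      rwa [htime, hconv, hdiv, hlap, fderiv_space_slice dl] at this)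
    (fun t x => by
      have := hcont t x
      rwa [htimediv, hdiv, (hasDerivAt_time_slice dl t x).deriv] at this)
    (fun t => by
      have := hfdual (w t) ((hwt t).of_le (by norm_num))
        (HasCompactSupport.intro hK fun x hx => by_contra fun h => hx (hsuppw t h))
      simp only [hfrob] at this
      exact this)
  have henergy : ∀ t, ∫ x, hybridEnergyDensity α β spaceDir u l (t, x) =
      (∫ x, ∑ i, w t x i ^ 2)
        + (α ^ 2)⁻¹ * ∫ x, (lam t x + 2 * β * vdiv (w t) x) ^ 2 := by
    intro t
    have huc : ∀ i, Continuous (u i) := fun i => (du i).continuous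
    have hlc : Continuous l := dl.continuous
    have hdivc : Continuous (dirDiv spaceDir u) := (contDiff_dirDiv hu2).continuous
    have h1 := integrable_space_slice (g := fun q => ∑ i, u i q ^ 2) hK (by fun_prop)
      (fun t x hx => by simp [hu0 _ t x hx]) t
    have h2 := integrable_space_slice (g := fun q => (l q + 2 * β * dirDiv spaceDir u q) ^ 2) hK
      (by fun_prop) (fun t x hx => by simp [hl0 t x hx, dirDiv,
        fderiv_eq_zero_of_vanish_off hK (hu0 _) t x hx]) t
    simp only [hdiv]
    rw [← integral_const_mul, ← integral_add h1 (h2.const_mul _)]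
    rfl
  rw [henergy, henergy] at hineq
  simp only [hfrob, hdiv] at hineq ⊢
  linarith
end
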